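/- Let n = 2m with m ≥ 2, and let A be a geodesic of SL(n) with the Hilbert–Schmidt metric. Suppose there are real numbers λ₁,…,λ_m, μ₁,…,μ_m, z₁,…,z_m such that A(0)ᵀ·A(0) = ⊕_{i=1}^m λ_i·I₂, A(0)ᵀ·A'(0) + A'(0)ᵀ·A(0) = ⊕_{i=1}^m μ_i·I₂, and A(0)ᵀ·A'(0) − A'(0)ᵀ·A(0) = ⊕_{i=1}^m z_i·Z₂. Suppose further there is m₀ with 1 ≤ m₀ < m such that |z₁| = ⋯ = |z_{m₀}| ≠ 0, |z_{m₀+1}| = ⋯ = |z_m| ≠ 0, λ₁ = ⋯ = λ_{m₀}, λ_{m₀+1} = ⋯ = λ_m, μ₁ = ⋯ = μ_{m₀}, and μ_{m₀+1} = ⋯ = μ_m. Then the solution is periodic: there exists T > 0 such that for all t ∈ ℝ, A(t+T)ᵀ·A(t+T) = A(t)ᵀ·A(t) and A(t+T)ᵀ·A'(t+T) = A(t)ᵀ·A'(t). -/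

import Mathlib

noncomputable section
open Matrix Filter

attribute [local instance] Matrix.normedAddCommGroup Matrix.normedSpace

/-- A geodesic of `SL(n)` with the Hilbert–Schmidt metric. -/
def IsGeodesic {ι : Type*} [Fintype ι] [DecidableEq ι] (A : ℝ → Matrix ι ι ℝ) : Prop :=
  (∀ t, DifferentiableAt ℝ A t) ∧ (∀ t, DifferentiableAt ℝ (deriv A) t) ∧
  (∀ t, (A t).det = 1) ∧
  (∀ t, deriv (deriv A) t =
    (Matrix.trace (deriv A t * (A t)⁻¹ * deriv A t * (A t)⁻¹) /
      Matrix.trace ((A t)⁻¹ * ((A t)⁻¹)ᵀ)) • ((A t)⁻¹)ᵀ)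

/-- The 2×2 rotation generator `Z₂`. -/
def Z2 : Matrix (Fin 2) (Fin 2) ℝ := !![0, -1; 1, 0]

/-- Two positive functions `s`, `r` with `s ^ p * r ^ q = 1`, each driven by a centrifugal term
and a common force `κ`. -/
structure PulsatingPair (p q α β : ℝ) (κ s r ds dr : ℝ → ℝ) : Prop where
  p_pos : 0 < p
  q_pos : 0 < q
  α_pos : 0 < α
  β_pos : 0 < β
  s_pos : ∀ t, 0 < s t
  r_pos : ∀ t, 0 < r t
  hasDerivAt_s : ∀ t, HasDerivAt s (ds t) t
  hasDerivAt_r : ∀ t, HasDerivAt r (dr t) t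
  hasDerivAt_ds : ∀ t, HasDerivAt ds (2 * ((ds t ^ 2 / 4 + α) / s t + κ t)) t
  hasDerivAt_dr : ∀ t, HasDerivAt dr (2 * ((dr t ^ 2 / 4 + β) / r t + κ t)) t
  log_eq : ∀ t, p * Real.log (s t) + q * Real.log (r t) = 0

namespace PulsatingPair

variable {p q α β : ℝ} {κ s r ds dr : ℝ → ℝ}

theorem symm (h : PulsatingPair p q α β κ s r ds dr) : PulsatingPair q p β α κ r s dr ds :=
  ⟨h.q_pos, h.p_pos, h.β_pos, h.α_pos, h.r_pos, h.s_pos, h.hasDerivAt_r, h.hasDerivAt_s,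
    h.hasDerivAt_dr, h.hasDerivAt_ds, fun t => by rw [add_comm]; exact h.log_eq t⟩

theorem logDeriv_eq (h : PulsatingPair p q α β κ s r ds dr) (t : ℝ) :
    p * (ds t / s t) + q * (dr t / r t) = 0 := by
  have h1 := (((h.hasDerivAt_s t).log (h.s_pos t).ne').const_mul p).add
    (((h.hasDerivAt_r t).log (h.r_pos t).ne').const_mul q)
  refine h1.unique ((hasDerivAt_const t (0 : ℝ)).congr_of_eventuallyEq ?_)
  exact Eventually.of_forall fun x => h.log_eq x

theorem exists_energy (h : PulsatingPair p q α β κ s r ds dr) :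
    ∃ E, ∀ t, p * ((ds t ^ 2 / 4 + α) / s t) + q * ((dr t ^ 2 / 4 + β) / r t) = E := by
  have key : ∀ t, HasDerivAt
      (fun t => p * ((ds t ^ 2 / 4 + α) / s t) + q * ((dr t ^ 2 / 4 + β) / r t)) 0 t := by
    intro t
    have hs := (h.s_pos t).ne'
    have hr := (h.r_pos t).ne'
    have h1 := ((((((h.hasDerivAt_ds t).pow 2).div_const 4).add_const α).div
      (h.hasDerivAt_s t) hs).const_mul p).add
      ((((((h.hasDerivAt_dr t).pow 2).div_const 4).add_const β).div
      (h.hasDerivAt_r t) hr).const_mul q)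
    refine h1.congr_deriv ?_
    have h2 : κ t * (p * (ds t / s t) + q * (dr t / r t)) = 0 := by rw [h.logDeriv_eq, mul_zero]
    rw [← h2]
    simp only [Pi.pow_apply]
    field_simp
    ring
  refine ⟨_, fun t => is_const_of_deriv_eq_zero (fun t => (key t).differentiableAt)
    (fun t => (key t).deriv) t 0⟩

theorem exists_le (h : PulsatingPair p q α β κ s r ds dr) : ∃ b, 0 < b ∧ ∀ t, s t ≤ b := by
  obtain ⟨E, hE⟩ := h.exists_energy
  have hq := h.q_pos
  have hp := h.p_pos
  have hβ := h.β_pos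
  have hα := h.α_pos
  have hr : ∀ t, q * β / r t < E := by
    intro t
    have hs := h.s_pos t
    have hr := h.r_pos t
    rw [← hE t]
    have h1 : 0 < p * ((ds t ^ 2 / 4 + α) / s t) := by positivity
    have h2 : 0 ≤ q * ((dr t ^ 2 / 4) / r t) := by positivity
    have h3 : q * ((dr t ^ 2 / 4 + β) / r t) = q * ((dr t ^ 2 / 4) / r t) + q * β / r t := by ring
    linarith
  have hE0 : 0 < E := lt_trans (by have := h.r_pos 0; positivity) (hr 0)
  refine ⟨Real.exp (-(q * Real.log (q * β / E)) / p), Real.exp_pos _, fun t => ?_⟩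
  rw [← Real.log_le_iff_le_exp (h.s_pos t), le_div_iff₀ hp]
  have h1 : q * β / E ≤ r t := by
    have := hr t
    rw [div_lt_iff₀ (h.r_pos t)] at this
    rw [div_le_iff₀ hE0]; linarith
  have h2 := Real.log_le_log (by positivity) h1
  have h3 := h.log_eq t
  nlinarith

/-- The kinetic part of the conserved energy. -/
def kinetic (p q : ℝ) (s r ds dr : ℝ → ℝ) (t : ℝ) : ℝ :=
  p * (ds t ^ 2 / (4 * s t)) + q * (dr t ^ 2 / (4 * r t))

theorem kinetic_eq (h : PulsatingPair p q α β κ s r ds dr) (t : ℝ) :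
    kinetic p q s r ds dr t = (ds t / s t) ^ 2 * ((p * s t + p ^ 2 / q * r t) / 4) := by
  have h1 := h.logDeriv_eq t
  have hq := h.q_pos.ne'
  have hs := (h.s_pos t).ne'
  have hr := (h.r_pos t).ne'
  have h2 : dr t = -(p / q) * (ds t / s t) * r t := by
    field_simp at h1 ⊢
    linarith
  rw [kinetic, h2]
  field_simp

theorem hasDerivAt_kinetic (h : PulsatingPair p q α β κ s r ds dr) (t : ℝ) :
    HasDerivAt (kinetic p q s r ds dr) (-(p * (ds t / s t) * (β / r t - α / s t))) t := by
  obtain ⟨E, hE⟩ := h.exists_energy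
  have h0 : kinetic p q s r ds dr = fun t => E - (p * α * (s t)⁻¹ + q * β * (r t)⁻¹) := by
    funext t
    have hs := (h.s_pos t).ne'
    have hr := (h.r_pos t).ne'
    rw [← hE t, kinetic]
    field_simp
    ring
  have hs := (h.s_pos t).ne'
  have hr := (h.r_pos t).ne'
  have h1 := ((((h.hasDerivAt_s t).inv hs).const_mul (p * α)).add
    (((h.hasDerivAt_r t).inv hr).const_mul (q * β))).const_sub E
  rw [h0]
  refine h1.congr_deriv ?_
  have h2 : q * dr t = -(p * (ds t / s t)) * r t := by
    have h1 := h.logDeriv_eq t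
    field_simp at h1 ⊢
    linarith
  have h3 : q * β * (-dr t / r t ^ 2) = -(β / r t ^ 2) * (q * dr t) := by ring
  rw [h3, h2]
  field_simp
  ring

theorem not_forall_pos (h : PulsatingPair p q α β κ s r ds dr) (T : ℝ) :
    ¬ ∀ t, T < t → 0 < ds t := by
  intro hpos
  have hp := h.p_pos
  have hq := h.q_pos
  obtain ⟨b, hb, hsb⟩ := h.exists_le
  obtain ⟨c, hc, hrc⟩ := h.symm.exists_le
  set N : ℝ := (p * b + p ^ 2 / q * c) / 4
  have hN : 0 < N := by positivity
  set v : ℝ → ℝ := fun t => ds t / s t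
  have hv : ∀ t, T < t → 0 < v t := fun t ht => div_pos (hpos t ht) (h.s_pos t)
  set K := kinetic p q s r ds dr
  have hK : ∀ t, T < t → 0 < K t := by
    intro t ht
    have h1 := h.s_pos t
    have h2 := h.r_pos t
    have h3 := hv t ht
    rw [show K t = _ from h.kinetic_eq t]
    positivity
  have hKN : ∀ t, T < t → √(K t) ≤ v t * √N := by
    intro t ht
    rw [show K t = _ from h.kinetic_eq t, Real.sqrt_mul (sq_nonneg _),
      Real.sqrt_sq (hv t ht).le]
    refine mul_le_mul_of_nonneg_left (Real.sqrt_le_sqrt ?_) (hv t ht).le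
    have h1 := hsb t
    have h2 := hrc t
    show (p * s t + p ^ 2 / q * r t) / 4 ≤ (p * b + p ^ 2 / q * c) / 4
    gcongr
  have hsqrt : ∀ t, T < t → HasDerivAt (fun t => √(K t))
      (-(p * v t * (β / r t - α / s t)) / (2 * √(K t))) t := fun t ht =>
    (h.hasDerivAt_kinetic t).sqrt (hK t ht).ne'
  set W : ℝ → ℝ := fun t => β / r t - α / s t
  have hWmono : ∀ x y, T < x → x ≤ y → W x ≤ W y := by
    intro x y hx hxy
    have hs : s x ≤ s y := by
      refine monotoneOn_of_deriv_nonneg (convex_Ioi T)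
        (fun t _ => (h.hasDerivAt_s t).continuousAt.continuousWithinAt)
        (fun t _ => (h.hasDerivAt_s t).differentiableAt.differentiableWithinAt) ?_ hx
        (lt_of_lt_of_le hx hxy) hxy
      intro t ht
      rw [interior_Ioi] at ht
      rw [(h.hasDerivAt_s t).deriv]
      exact (hpos t ht).le
    have hr : r y ≤ r x := by
      have h1 := h.log_eq x
      have h2 := h.log_eq y
      have h3 := Real.log_le_log (h.s_pos x) hs
      rw [← Real.log_le_log_iff (h.r_pos y) (h.r_pos x)]
      nlinarith
    have h1 := div_le_div_of_nonneg_left h.β_pos.le (h.r_pos y) hr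
    have h2 := div_le_div_of_nonneg_left h.α_pos.le (h.s_pos x) hs
    show β / r x - α / s x ≤ β / r y - α / s y
    linarith
  by_cases hW : ∃ t, T < t ∧ 0 < W t
  · obtain ⟨t₁, ht₁, hW₁⟩ := hW
    set k : ℝ := p * W t₁ / (2 * √N)
    have hk : 0 < k := by positivity
    have hle : ∀ t, t₁ ≤ t → √(K t) ≤ √(K t₁) + (-k) * (t - t₁) := by
      intro t ht
      have := Convex.image_sub_le_mul_sub_of_deriv_le (convex_Ici t₁)
        (f := fun t => √(K t)) (C := -k)
        (fun x hx => (hsqrt x (lt_of_lt_of_le ht₁ hx)).continuousAt.continuousWithinAt)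
        (fun x hx => (hsqrt x (lt_of_lt_of_le ht₁
          (interior_subset hx))).differentiableAt.differentiableWithinAt)
        (fun x hx => ?_) t₁ Set.self_mem_Ici t ht ht
      · linarith
      · have hx' : t₁ ≤ x := interior_subset hx
        have hTx := lt_of_lt_of_le ht₁ hx'
        rw [(hsqrt x hTx).deriv, neg_div, neg_le_neg_iff]
        have h1 := hWmono t₁ x ht₁ hx'
        have h2 := hKN x hTx
        have h3 : 0 < √(K x) := Real.sqrt_pos.2 (hK x hTx)
        have h4 := hv x hTx
        have h5 : 0 ≤ p * W x := (mul_pos hp (hW₁.trans_le h1)).le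
        rw [div_le_div_iff₀ (by positivity) (by positivity)]
        calc p * W t₁ * (2 * √(K x)) ≤ p * W x * (2 * (v x * √N)) := by gcongr
          _ = p * v x * (β / r x - α / s x) * (2 * √N) := by ring
    have h1 := hle (t₁ + √(K t₁) / k + 1) (by
      have : 0 ≤ √(K t₁) / k := by positivity
      linarith)
    have h2 : √(K t₁) + (-k) * (t₁ + √(K t₁) / k + 1 - t₁) = -k := by field_simp; ring
    rw [h2] at h1
    have := Real.sqrt_nonneg (K (t₁ + √(K t₁) / k + 1))
    linarith
  · push Not at hW
    set t₁ := T + 1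
    have ht₁ : T < t₁ := lt_add_one T
    have hge : ∀ t, t₁ ≤ t → √(K t₁) ≤ √(K t) := by
      intro t ht
      refine monotoneOn_of_deriv_nonneg (convex_Ici t₁) (f := fun t => √(K t))
        (fun x hx => (hsqrt x (lt_of_lt_of_le ht₁ hx)).continuousAt.continuousWithinAt)
        (fun x hx => (hsqrt x (lt_of_lt_of_le ht₁
          (interior_subset hx))).differentiableAt.differentiableWithinAt)
        (fun x hx => ?_) Set.self_mem_Ici ht ht
      have hTx : T < x := lt_of_lt_of_le ht₁ (interior_subset hx)
      rw [(hsqrt x hTx).deriv]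
      have h1 : W x ≤ 0 := hW x hTx
      have h2 := mul_nonneg (mul_pos hp (hv x hTx)).le (neg_nonneg.2 h1)
      refine div_nonneg ?_ (by positivity)
      linarith [h2, show p * v x * -W x = -(p * v x * (β / r x - α / s x)) by ring]
    set k : ℝ := √(K t₁) / √N
    have hk : 0 < k := div_pos (Real.sqrt_pos.2 (hK _ ht₁)) (Real.sqrt_pos.2 hN)
    have hlog : ∀ t, HasDerivAt (fun t => Real.log (s t)) (v t) t := fun t =>
      (h.hasDerivAt_s t).log (h.s_pos t).ne'
    have hle : ∀ t, t₁ ≤ t → k * (t - t₁) ≤ Real.log (s t) - Real.log (s t₁) := by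
      intro t ht
      refine Convex.mul_sub_le_image_sub_of_le_deriv (convex_Ici t₁)
        (f := fun t => Real.log (s t))
        (fun x _ => (hlog x).continuousAt.continuousWithinAt)
        (fun x _ => (hlog x).differentiableAt.differentiableWithinAt)
        (fun x hx => ?_) t₁ Set.self_mem_Ici t ht ht
      have hx' : t₁ ≤ x := interior_subset hx
      rw [(hlog x).deriv, div_le_iff₀ (Real.sqrt_pos.2 hN)]
      exact (hge x hx').trans (hKN x (lt_of_lt_of_le ht₁ hx'))
    have h0 := Real.log_le_log (h.s_pos t₁) (hsb t₁)
    have h1 := hle (t₁ + (Real.log b - Real.log (s t₁)) / k + 1) (by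
      have : 0 ≤ (Real.log b - Real.log (s t₁)) / k := div_nonneg (by linarith) hk.le
      linarith)
    have h2 := Real.log_le_log (h.s_pos _)
      (hsb (t₁ + (Real.log b - Real.log (s t₁)) / k + 1))
    have h3 : k * (t₁ + (Real.log b - Real.log (s t₁)) / k + 1 - t₁) =
      Real.log b - Real.log (s t₁) + k := by field_simp; ring
    linarith

theorem deriv_eq_zero_iff (h : PulsatingPair p q α β κ s r ds dr) (t : ℝ) :
    ds t = 0 ↔ dr t = 0 := by
  have h1 := h.logDeriv_eq t
  have := h.p_pos.ne'
  have := h.q_pos.ne'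
  have := (h.s_pos t).ne'
  have := (h.r_pos t).ne'
  constructor <;> intro h2 <;> simpa [h2, *] using h1

theorem exists_deriv_eq_zero (h : PulsatingPair p q α β κ s r ds dr) (T : ℝ) :
    ∃ t, T < t ∧ ds t = 0 := by
  by_contra! hne
  have hcont : ContinuousOn ds (Set.Ioi T) := fun t _ =>
    (h.hasDerivAt_ds t).continuousAt.continuousWithinAt
  have hsign : (∀ t, T < t → 0 < ds t) ∨ ∀ t, T < t → ds t < 0 := by
    by_contra! hcon
    obtain ⟨⟨x, hx, hx0⟩, y, hy, hy0⟩ := hcon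
    obtain ⟨t, ht, ht0⟩ := isPreconnected_Ioi.intermediate_value hx hy hcont ⟨hx0, hy0⟩
    exact hne t ht ht0
  rcases hsign with hpos | hneg
  · exact h.not_forall_pos T hpos
  · refine h.symm.not_forall_pos T fun t ht => ?_
    have h1 := h.logDeriv_eq t
    have h2 := mul_neg_of_pos_of_neg h.p_pos (div_neg_of_neg_of_pos (hneg t ht) (h.s_pos t))
    have h3 : 0 < q * (dr t / r t) := by linarith
    have h4 := pos_of_mul_pos_right h3 h.q_pos.le
    exact (div_pos_iff_of_pos_right (h.r_pos t)).1 h4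

end PulsatingPair

theorem eq_of_hasDerivAt_of_contDiffAt {E : Type*} [NormedAddCommGroup E] [NormedSpace ℝ E]
    {v : E → E} {f g : ℝ → E} (hf : ∀ t, HasDerivAt f (v (f t)) t)
    (hg : ∀ t, HasDerivAt g (v (g t)) t) (hv : ∀ t, ContDiffAt ℝ 1 v (f t)) {t₀ : ℝ}
    (h₀ : f t₀ = g t₀) : f = g := by
  have hfc : Continuous f := continuous_iff_continuousAt.2 fun t => (hf t).continuousAt
  have hgc : Continuous g := continuous_iff_continuousAt.2 fun t => (hg t).continuousAt
  have hclopen : IsClopen {t | f t = g t} := by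
    refine ⟨isClosed_eq hfc hgc, isOpen_iff_mem_nhds.2 fun t ht => ?_⟩
    obtain ⟨K, s, hs, hK⟩ := (hv t).exists_lipschitzOnWith
    exact ODE_solution_unique_of_eventually (v := fun _ => v) (s := fun _ => s)
      (Eventually.of_forall fun _ => hK)
      ((hfc.continuousAt.eventually hs).mono fun x hx => ⟨hf x, hx⟩)
      ((hgc.continuousAt.eventually (by rw [← ht.out]; exact hs)).mono
        fun x hx => ⟨hg x, hx⟩) ht
  funext t
  have := hclopen.eq_univ ⟨t₀, h₀⟩
  exact (Set.eq_univ_iff_forall.1 this t)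

section Calculus
variable {l m n : Type*} [Fintype n]
variable {E : Type*} [NormedAddCommGroup E] [NormedSpace ℝ E]

theorem Matrix.contDiffAt_iff [Fintype m] {f : E → Matrix m n ℝ} {x : E} {k : WithTop ℕ∞} :
    ContDiffAt ℝ k f x ↔ ∀ i j, ContDiffAt ℝ k (fun x => f x i j) x :=
  (contDiffAt_pi (𝕜 := ℝ) (Φ := fun x i => f x i)).trans (forall_congr' fun _ => contDiffAt_pi)

theorem Matrix.hasDerivAt_iff {f : ℝ → Matrix m n ℝ} {f' : Matrix m n ℝ} {t : ℝ} :
    HasDerivAt f f' t ↔ ∀ i j, HasDerivAt (fun x => f x i j) (f' i j) t :=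
  (hasDerivAt_pi (φ := fun x i => f x i)).trans (forall_congr' fun _ => hasDerivAt_pi)

theorem HasDerivAt.matrix_transpose [Fintype m] {f : ℝ → Matrix m n ℝ} {f' : Matrix m n ℝ} {t : ℝ}
    (hf : HasDerivAt f f' t) : HasDerivAt (fun x => (f x)ᵀ) f'ᵀ t :=
  Matrix.hasDerivAt_iff.2 fun i j => Matrix.hasDerivAt_iff.1 hf j i

theorem HasDerivAt.matrix_mul [Fintype m] {f : ℝ → Matrix l m ℝ} {g : ℝ → Matrix m n ℝ}
    {f' : Matrix l m ℝ} {g' : Matrix m n ℝ} {t : ℝ}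
    (hf : HasDerivAt f f' t) (hg : HasDerivAt g g' t) :
    HasDerivAt (fun x => f x * g x) (f' * g t + f t * g') t := by
  refine Matrix.hasDerivAt_iff.2 fun i j => ?_
  simp only [Matrix.mul_apply, Matrix.add_apply, ← Finset.sum_add_distrib]
  exact HasDerivAt.fun_sum fun k _ =>
    (Matrix.hasDerivAt_iff.1 hf i k).mul (Matrix.hasDerivAt_iff.1 hg k j)

theorem ContDiffAt.matrix_transpose [Fintype m] {f : E → Matrix m n ℝ} {x : E} {k : WithTop ℕ∞}
    (hf : ContDiffAt ℝ k f x) : ContDiffAt ℝ k (fun x => (f x)ᵀ) x :=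
  Matrix.contDiffAt_iff.2 fun i j => Matrix.contDiffAt_iff.1 hf j i

theorem ContDiffAt.matrix_mul [Fintype l] [Fintype m] {f : E → Matrix l m ℝ} {g : E → Matrix m n ℝ} {x : E}
    {k : WithTop ℕ∞} (hf : ContDiffAt ℝ k f x) (hg : ContDiffAt ℝ k g x) :
    ContDiffAt ℝ k (fun x => f x * g x) x := by
  refine Matrix.contDiffAt_iff.2 fun i j => ?_
  simp only [Matrix.mul_apply]
  exact ContDiffAt.sum fun c _ =>
    (Matrix.contDiffAt_iff.1 hf i c).mul (Matrix.contDiffAt_iff.1 hg c j)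

theorem ContDiffAt.matrix_trace {f : E → Matrix n n ℝ} {x : E} {k : WithTop ℕ∞}
    (hf : ContDiffAt ℝ k f x) : ContDiffAt ℝ k (fun x => (f x).trace) x :=
  ContDiffAt.sum fun c _ => Matrix.contDiffAt_iff.1 hf c c

theorem ContDiffAt.matrix_det [DecidableEq n] {f : E → Matrix n n ℝ} {x : E} {k : WithTop ℕ∞}
    (hf : ContDiffAt ℝ k f x) : ContDiffAt ℝ k (fun x => (f x).det) x := by
  simp only [Matrix.det_apply']
  exact ContDiffAt.sum fun σ _ => contDiffAt_const.mul
    (contDiffAt_prod fun c _ => Matrix.contDiffAt_iff.1 hf (σ c) c)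

theorem ContDiffAt.matrix_inv [DecidableEq n] {f : E → Matrix n n ℝ} {x : E} {k : WithTop ℕ∞}
    (hf : ContDiffAt ℝ k f x) (h0 : (f x).det ≠ 0) : ContDiffAt ℝ k (fun x => (f x)⁻¹) x := by
  simp only [Matrix.inv_def, Ring.inverse_eq_inv']
  refine (hf.matrix_det.inv h0).smul (Matrix.contDiffAt_iff.2 fun i j => ?_)
  simp only [Matrix.adjugate_apply]
  refine ContDiffAt.matrix_det (Matrix.contDiffAt_iff.2 fun a b => ?_)
  simp only [Matrix.updateRow_apply]
  split_ifs
  · exact contDiffAt_const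
  · exact Matrix.contDiffAt_iff.1 hf a b

end Calculus

section Geodesic
variable {ι : Type*} [Fintype ι] [DecidableEq ι]

/-- The constraint force of the geodesic equation at position `X` and velocity `Y`. -/
def geodesicForce (X Y : Matrix ι ι ℝ) : ℝ :=
  Matrix.trace (Y * X⁻¹ * Y * X⁻¹) / Matrix.trace (X⁻¹ * (X⁻¹)ᵀ)

theorem Matrix.trace_inv_mul_transpose_inv_ne_zero [Nonempty ι] {X : Matrix ι ι ℝ}
    (hX : X.det ≠ 0) : Matrix.trace (X⁻¹ * (X⁻¹)ᵀ) ≠ 0 := by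
  intro h
  have h1 : X⁻¹ = 0 := by
    rw [← conjTranspose_eq_transpose_of_trivial] at h
    exact Matrix.trace_mul_conjTranspose_self_eq_zero_iff.1 h
  have h2 := Matrix.mul_nonsing_inv X (Ne.isUnit hX)
  rw [h1, mul_zero] at h2
  exact zero_ne_one h2

theorem contDiffAt_geodesicField [Nonempty ι] {P : Matrix ι ι ℝ × Matrix ι ι ℝ}
    (hP : P.1.det ≠ 0) :
    ContDiffAt ℝ 1 (fun P : Matrix ι ι ℝ × Matrix ι ι ℝ =>
      (P.2, geodesicForce P.1 P.2 • (P.1⁻¹)ᵀ)) P := by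
  have hX : ContDiffAt ℝ 1 (fun P : Matrix ι ι ℝ × Matrix ι ι ℝ => P.1⁻¹) P :=
    contDiffAt_fst.matrix_inv hP
  have hY : ContDiffAt ℝ 1 (fun P : Matrix ι ι ℝ × Matrix ι ι ℝ => P.2) P := contDiffAt_snd
  have hF : ContDiffAt ℝ 1
      (fun P : Matrix ι ι ℝ × Matrix ι ι ℝ => geodesicForce P.1 P.2) P :=
    (((hY.matrix_mul hX).matrix_mul hY).matrix_mul hX).matrix_trace.div
    (hX.matrix_mul hX.matrix_transpose).matrix_trace
    (Matrix.trace_inv_mul_transpose_inv_ne_zero hP)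
  exact hY.prodMk (hF.smul hX.matrix_transpose)

theorem IsGeodesic.hasDerivAt {A : ℝ → Matrix ι ι ℝ} (hA : IsGeodesic A) (t : ℝ) :
    HasDerivAt A (deriv A t) t := (hA.1 t).hasDerivAt

theorem IsGeodesic.hasDerivAt_deriv {A : ℝ → Matrix ι ι ℝ} (hA : IsGeodesic A) (t : ℝ) :
    HasDerivAt (deriv A) (geodesicForce (A t) (deriv A t) • ((A t)⁻¹)ᵀ) t :=
  (hA.2.1 t).hasDerivAt.congr_deriv (hA.2.2.2 t)

theorem IsGeodesic.isUnit_det {A : ℝ → Matrix ι ι ℝ} (hA : IsGeodesic A) (t : ℝ) :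
    IsUnit (A t).det := by rw [hA.2.2.1 t]; exact isUnit_one

/-- Orthogonal transformations from either side and time reversal leave the force
equivariant. -/
theorem geodesicForce_conj {O R X Y : Matrix ι ι ℝ} {ε : ℝ} (hε : ε * ε = 1)
    (hO : Oᵀ * O = 1) (hR : Rᵀ * R = 1) :
    geodesicForce (O * X * R) (ε • (O * Y * R)) • ((O * X * R)⁻¹)ᵀ =
      O * (geodesicForce X Y • (X⁻¹)ᵀ) * R := by
  have hO' : O⁻¹ = Oᵀ := Matrix.inv_eq_left_inv hO
  have hR' : R⁻¹ = Rᵀ := Matrix.inv_eq_left_inv hR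
  have hR2 : R * Rᵀ = 1 := mul_eq_one_comm.1 hR
  have hinv : (O * X * R)⁻¹ = Rᵀ * X⁻¹ * Oᵀ := by
    rw [Matrix.mul_inv_rev, Matrix.mul_inv_rev, hO', hR', Matrix.mul_assoc]
  have h1 : ε • (O * Y * R) * (Rᵀ * X⁻¹ * Oᵀ) = ε • (O * (Y * X⁻¹) * Oᵀ) := by
    rw [Matrix.smul_mul]
    congr 1
    calc O * Y * R * (Rᵀ * X⁻¹ * Oᵀ) = O * Y * (R * Rᵀ) * X⁻¹ * Oᵀ := by
          simp only [Matrix.mul_assoc]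
      _ = _ := by rw [hR2]; simp only [Matrix.mul_assoc, Matrix.mul_one]
  have h2 : ε • (O * (Y * X⁻¹) * Oᵀ) * (ε • (O * (Y * X⁻¹) * Oᵀ)) =
      O * (Y * X⁻¹ * Y * X⁻¹) * Oᵀ := by
    rw [Matrix.smul_mul, Matrix.mul_smul, smul_smul, hε, one_smul]
    calc O * (Y * X⁻¹) * Oᵀ * (O * (Y * X⁻¹) * Oᵀ)
        = O * (Y * X⁻¹) * (Oᵀ * O) * (Y * X⁻¹) * Oᵀ := by simp only [Matrix.mul_assoc]
      _ = _ := by rw [hO]; simp only [Matrix.mul_assoc, Matrix.one_mul]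
  have h3 : Rᵀ * X⁻¹ * Oᵀ * (Rᵀ * X⁻¹ * Oᵀ)ᵀ = Rᵀ * (X⁻¹ * (X⁻¹)ᵀ) * R := by
    simp only [Matrix.transpose_mul, Matrix.transpose_transpose]
    calc Rᵀ * X⁻¹ * Oᵀ * (O * ((X⁻¹)ᵀ * R))
        = Rᵀ * X⁻¹ * (Oᵀ * O) * (X⁻¹)ᵀ * R := by simp only [Matrix.mul_assoc]
      _ = _ := by rw [hO]; simp only [Matrix.mul_assoc, Matrix.one_mul]
  have hforce : geodesicForce (O * X * R) (ε • (O * Y * R)) = geodesicForce X Y := by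
    unfold geodesicForce
    rw [hinv, h1, Matrix.mul_assoc, h1, h2, h3, Matrix.trace_mul_comm, ← Matrix.mul_assoc, hO,
      Matrix.one_mul, Matrix.trace_mul_comm (Rᵀ * _), ← Matrix.mul_assoc, hR2, Matrix.one_mul]
  rw [hforce, hinv, Matrix.mul_smul, Matrix.smul_mul]
  simp only [Matrix.transpose_mul, Matrix.transpose_transpose, Matrix.mul_assoc]

theorem IsGeodesic.equivariance [Nonempty ι] {A : ℝ → Matrix ι ι ℝ} (hA : IsGeodesic A)
    {R : Matrix ι ι ℝ} (hR : Rᵀ * R = 1) {ε t₀ t₁ : ℝ} (hε : ε * ε = 1)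
    (h₀ : Rᵀ * ((A t₀)ᵀ * A t₀) * R = (A t₁)ᵀ * A t₁)
    (h₁ : ε • (Rᵀ * ((A t₀)ᵀ * deriv A t₀) * R) = (A t₁)ᵀ * deriv A t₁) (t : ℝ) :
    Rᵀ * ((A (t₀ + ε * t))ᵀ * A (t₀ + ε * t)) * R = (A (t₁ + t))ᵀ * A (t₁ + t) ∧
    ε • (Rᵀ * ((A (t₀ + ε * t))ᵀ * deriv A (t₀ + ε * t)) * R) =
      (A (t₁ + t))ᵀ * deriv A (t₁ + t) := by
  have hR2 : R * Rᵀ = 1 := mul_eq_one_comm.1 hR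
  have hinv₀ : (A t₀)⁻¹ * A t₀ = 1 := Matrix.nonsing_inv_mul _ (hA.isUnit_det t₀)
  have hinv₀' : (A t₀)ᵀ⁻¹ * (A t₀)ᵀ = 1 :=
    Matrix.nonsing_inv_mul _ (by rw [det_transpose]; exact hA.isUnit_det t₀)
  have hinv₁ : (A t₁)ᵀ⁻¹ * (A t₁)ᵀ = 1 :=
    Matrix.nonsing_inv_mul _ (by rw [det_transpose]; exact hA.isUnit_det t₁)
  set O : Matrix ι ι ℝ := A t₁ * Rᵀ * (A t₀)⁻¹ with hOdef
  have hO : Oᵀ * O = 1 := by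
    have hinv₀'' : (A t₀) * (A t₀)⁻¹ = 1 := Matrix.mul_nonsing_inv _ (hA.isUnit_det t₀)
    calc Oᵀ * O = ((A t₀)⁻¹)ᵀ * R * ((A t₁)ᵀ * A t₁) * Rᵀ * (A t₀)⁻¹ := by
          simp only [hOdef, Matrix.transpose_mul, Matrix.transpose_transpose, Matrix.mul_assoc]
      _ = ((A t₀)⁻¹)ᵀ * (R * Rᵀ) * ((A t₀)ᵀ * A t₀) * (R * Rᵀ) * (A t₀)⁻¹ := by
          rw [← h₀]; simp only [Matrix.mul_assoc]
      _ = ((A t₀)⁻¹)ᵀ * (A t₀)ᵀ * (A t₀ * (A t₀)⁻¹) := by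
          rw [hR2]; simp only [Matrix.mul_assoc, Matrix.mul_one]
      _ = 1 := by rw [hinv₀'', ← Matrix.transpose_mul, hinv₀'', Matrix.transpose_one, one_mul]
  have hOA : O * A t₀ * R = A t₁ := by
    calc O * A t₀ * R = A t₁ * Rᵀ * ((A t₀)⁻¹ * A t₀) * R := by
          simp only [hOdef, Matrix.mul_assoc]
      _ = A t₁ := by rw [hinv₀, Matrix.mul_one, Matrix.mul_assoc, hR, Matrix.mul_one]
  have hOA' : ε • (O * deriv A t₀ * R) = deriv A t₁ := by
    have h2 : (A t₁)ᵀ * (ε • (O * deriv A t₀ * R)) = (A t₁)ᵀ * deriv A t₁ := by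
      rw [← h₁, Matrix.mul_smul, ← hOA]
      congr 1
      calc (O * A t₀ * R)ᵀ * (O * deriv A t₀ * R)
          = Rᵀ * (A t₀)ᵀ * (Oᵀ * O) * deriv A t₀ * R := by
            simp only [Matrix.transpose_mul, Matrix.mul_assoc]
        _ = _ := by rw [hO]; simp only [Matrix.mul_assoc, Matrix.one_mul]
    calc ε • (O * deriv A t₀ * R)
        = (A t₁)ᵀ⁻¹ * ((A t₁)ᵀ * (ε • (O * deriv A t₀ * R))) := by
          rw [← Matrix.mul_assoc, hinv₁, Matrix.one_mul]
      _ = _ := by rw [h2, ← Matrix.mul_assoc, hinv₁, Matrix.one_mul]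
  have hconst : ∀ (M : Matrix ι ι ℝ) (t : ℝ), HasDerivAt (fun _ => M) 0 t :=
    fun M t => hasDerivAt_const t M
  have haff : ∀ t : ℝ, HasDerivAt (fun t => t₀ + ε * t) ε t := fun t => by
    simpa using ((hasDerivAt_id t).const_mul ε).const_add t₀
  have hf : ∀ t, HasDerivAt (fun t => (O * A (t₀ + ε * t) * R, ε • (O * deriv A (t₀ + ε * t) * R)))
      ((ε • (O * deriv A (t₀ + ε * t) * R)), geodesicForce (O * A (t₀ + ε * t) * R)
        (ε • (O * deriv A (t₀ + ε * t) * R)) • ((O * A (t₀ + ε * t) * R)⁻¹)ᵀ) t := by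
    intro t
    refine HasDerivAt.prodMk ?_ ?_
    · have := ((hconst O t).matrix_mul ((hA.hasDerivAt _).scomp t (haff t))).matrix_mul (hconst R t)
      refine this.congr_deriv ?_
      simp
    · rw [geodesicForce_conj hε hO hR]
      have := (((hconst O t).matrix_mul ((hA.hasDerivAt_deriv _).scomp t (haff t))).matrix_mul
        (hconst R t)).const_smul ε
      refine this.congr_deriv ?_
      simp [smul_smul, hε, ← mul_assoc]
  have hg : ∀ t, HasDerivAt (fun t => (A (t₁ + t), deriv A (t₁ + t)))
      (deriv A (t₁ + t), geodesicForce (A (t₁ + t)) (deriv A (t₁ + t)) • ((A (t₁ + t))⁻¹)ᵀ) t :=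
    fun t => ((hA.hasDerivAt _).comp_const_add t₁ t).prodMk
      ((hA.hasDerivAt_deriv _).comp_const_add t₁ t)
  have heq := eq_of_hasDerivAt_of_contDiffAt
    (v := fun P : Matrix ι ι ℝ × Matrix ι ι ℝ => (P.2, geodesicForce P.1 P.2 • (P.1⁻¹)ᵀ))
    hg hf (fun t => contDiffAt_geodesicField (hA.isUnit_det _).ne_zero) (t₀ := 0)
    (by simp [hOA, hOA'])
  have ht := congrFun heq t
  rw [Prod.mk.injEq] at ht
  rw [ht.1, ht.2, Matrix.mul_smul]
  constructor
  · calc _ = Rᵀ * (A (t₀ + ε * t))ᵀ * 1 * A (t₀ + ε * t) * R := by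
          simp only [Matrix.mul_assoc, Matrix.one_mul]
      _ = _ := by rw [← hO]; simp only [Matrix.transpose_mul, Matrix.mul_assoc]
  · congr 1
    calc _ = Rᵀ * (A (t₀ + ε * t))ᵀ * 1 * deriv A (t₀ + ε * t) * R := by
          simp only [Matrix.mul_assoc, Matrix.one_mul]
      _ = _ := by rw [← hO]; simp only [Matrix.transpose_mul, Matrix.mul_assoc]

/-- The matrix of the signed permutation `e_y ↦ d y • e_(σ y)`. -/
def signedPerm (σ : ι ≃ ι) (d : ι → ℝ) : Matrix ι ι ℝ :=
  Matrix.of fun x y => if x = σ y then d y else 0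

theorem signedPerm_conj_apply (σ : ι ≃ ι) (d : ι → ℝ) (M : Matrix ι ι ℝ) (x y : ι) :
    ((signedPerm σ d)ᵀ * M * signedPerm σ d) x y = d x * d y * M (σ x) (σ y) := by
  simp only [signedPerm, Matrix.mul_apply, Matrix.transpose_apply, Matrix.of_apply, ite_mul,
    zero_mul, mul_ite, mul_zero, Finset.sum_ite_eq', Finset.mem_univ, if_true]
  ring

theorem signedPerm_orthogonal (σ : ι ≃ ι) {d : ι → ℝ} (hd : ∀ x, d x * d x = 1) :
    (signedPerm σ d)ᵀ * signedPerm σ d = 1 := by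
  rw [← Matrix.mul_one (signedPerm σ d)ᵀ]
  ext x y
  rw [signedPerm_conj_apply, Matrix.one_apply, Matrix.one_apply]
  by_cases h : x = y
  · simp [h, hd]
  · simp [h]

theorem IsGeodesic.signedPerm_equivariance [Nonempty ι] {A : ℝ → Matrix ι ι ℝ}
    (hA : IsGeodesic A) (σ : ι ≃ ι) {d : ι → ℝ} (hd : ∀ x, d x * d x = 1) {ε t₀ t₁ : ℝ}
    (hε : ε * ε = 1)
    (h₀ : ∀ x y, d x * d y * ((A t₀)ᵀ * A t₀) (σ x) (σ y) = ((A t₁)ᵀ * A t₁) x y)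
    (h₁ : ∀ x y, ε * (d x * d y * ((A t₀)ᵀ * deriv A t₀) (σ x) (σ y)) =
      ((A t₁)ᵀ * deriv A t₁) x y) (t : ℝ) (x y : ι) :
    d x * d y * ((A (t₀ + ε * t))ᵀ * A (t₀ + ε * t)) (σ x) (σ y) =
      ((A (t₁ + t))ᵀ * A (t₁ + t)) x y ∧
    ε * (d x * d y * ((A (t₀ + ε * t))ᵀ * deriv A (t₀ + ε * t)) (σ x) (σ y)) =
      ((A (t₁ + t))ᵀ * deriv A (t₁ + t)) x y := by
  have h := hA.equivariance (signedPerm_orthogonal σ hd) hε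
    (by ext x y; rw [signedPerm_conj_apply, h₀])
    (by ext x y; rw [Matrix.smul_apply, signedPerm_conj_apply, smul_eq_mul, h₁]) t
  rw [← h.1, ← h.2, Matrix.smul_apply, signedPerm_conj_apply, signedPerm_conj_apply, smul_eq_mul]
  exact ⟨rfl, rfl⟩

theorem IsGeodesic.hasDerivAt_gram {A : ℝ → Matrix ι ι ℝ} (hA : IsGeodesic A) (t : ℝ) :
    HasDerivAt (fun t => (A t)ᵀ * A t) ((A t)ᵀ * deriv A t + ((A t)ᵀ * deriv A t)ᵀ) t := by
  refine ((hA.hasDerivAt t).matrix_transpose.matrix_mul (hA.hasDerivAt t)).congr_deriv ?_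
  rw [Matrix.transpose_mul, Matrix.transpose_transpose, add_comm]

theorem IsGeodesic.hasDerivAt_momentum {A : ℝ → Matrix ι ι ℝ} (hA : IsGeodesic A) (t : ℝ) :
    HasDerivAt (fun t => (A t)ᵀ * deriv A t)
      ((deriv A t)ᵀ * deriv A t + geodesicForce (A t) (deriv A t) • (1 : Matrix ι ι ℝ)) t := by
  refine ((hA.hasDerivAt t).matrix_transpose.matrix_mul (hA.hasDerivAt_deriv t)).congr_deriv ?_
  rw [Matrix.mul_smul, ← Matrix.transpose_mul, Matrix.nonsing_inv_mul _ (hA.isUnit_det t),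
    Matrix.transpose_one]

theorem IsGeodesic.transpose_deriv_mul_deriv {A : ℝ → Matrix ι ι ℝ} (hA : IsGeodesic A) (t : ℝ) :
    (deriv A t)ᵀ * deriv A t =
      ((A t)ᵀ * deriv A t)ᵀ * (((A t)ᵀ * A t)⁻¹ * ((A t)ᵀ * deriv A t)) := by
  have h1 : (A t) * (A t)⁻¹ = 1 := Matrix.mul_nonsing_inv _ (hA.isUnit_det t)
  have h2 : ((A t)ᵀ)⁻¹ * (A t)ᵀ = 1 :=
    Matrix.nonsing_inv_mul _ (by rw [det_transpose]; exact hA.isUnit_det t)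
  calc (deriv A t)ᵀ * deriv A t
      = (deriv A t)ᵀ * ((A t) * (A t)⁻¹) * (((A t)ᵀ)⁻¹ * (A t)ᵀ) * deriv A t := by
        rw [h1, h2, Matrix.mul_one, Matrix.mul_one]
    _ = _ := by
        rw [Matrix.mul_inv_rev, Matrix.transpose_mul, Matrix.transpose_transpose]
        simp only [Matrix.mul_assoc]

/-- The angular momentum `AᵀA' - A'ᵀA` is conserved. -/
theorem IsGeodesic.angularMomentum_eq {A : ℝ → Matrix ι ι ℝ} (hA : IsGeodesic A) (t : ℝ) :
    (A t)ᵀ * deriv A t - ((A t)ᵀ * deriv A t)ᵀ = (A 0)ᵀ * deriv A 0 - ((A 0)ᵀ * deriv A 0)ᵀ := by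
  have h : ∀ t, HasDerivAt (fun t => (A t)ᵀ * deriv A t - ((A t)ᵀ * deriv A t)ᵀ) 0 t := by
    intro t
    refine ((hA.hasDerivAt_momentum t).sub
      (hA.hasDerivAt_momentum t).matrix_transpose).congr_deriv ?_
    simp
  exact is_const_of_deriv_eq_zero (fun t => (h t).differentiableAt) (fun t => (h t).deriv) t 0

end Geodesic

/-- Block-diagonal initial data for which the blocks fall into two classes, split at `m₀`. -/
structure TwoClassData {m : ℕ} (m₀ : ℕ) (A : ℝ → Matrix (Fin 2 × Fin m) (Fin 2 × Fin m) ℝ)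
    (lam mu z : Fin m → ℝ) : Prop where
  geodesic : IsGeodesic A
  gram_zero : ∀ x y, ((A 0)ᵀ * A 0) x y = if x = y then lam x.2 else 0
  momentum_zero : ∀ x y, ((A 0)ᵀ * deriv A 0) x y =
    if x = y then mu x.2 / 2 else if x.2 = y.2 then z x.2 * Z2 x.1 y.1 / 2 else 0
  ne_zero : ∀ i, z i ≠ 0
  sq_eq : ∀ i j : Fin m, ((i : ℕ) < m₀ ↔ (j : ℕ) < m₀) → z i ^ 2 = z j ^ 2
  lam_eq : ∀ i j : Fin m, ((i : ℕ) < m₀ ↔ (j : ℕ) < m₀) → lam i = lam j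
  mu_eq : ∀ i j : Fin m, ((i : ℕ) < m₀ ↔ (j : ℕ) < m₀) → mu i = mu j

theorem Z2_apply_self (a : Fin 2) : Z2 a a = 0 := by fin_cases a <;> simp [Z2]

namespace TwoClassData

variable {m m₀ : ℕ} {A : ℝ → Matrix (Fin 2 × Fin m) (Fin 2 × Fin m) ℝ} {lam mu z : Fin m → ℝ}

theorem gram_signedPerm (h : TwoClassData m₀ A lam mu z) (σ : Fin 2 × Fin m ≃ Fin 2 × Fin m)
    {d : Fin 2 × Fin m → ℝ} (hd : ∀ x, d x * d x = 1)
    (h₀ : ∀ x y, d x * d y * ((A 0)ᵀ * A 0) (σ x) (σ y) = ((A 0)ᵀ * A 0) x y)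
    (h₁ : ∀ x y, d x * d y * ((A 0)ᵀ * deriv A 0) (σ x) (σ y) = ((A 0)ᵀ * deriv A 0) x y)
    (t : ℝ) (x y : Fin 2 × Fin m) :
    d x * d y * ((A t)ᵀ * A t) (σ x) (σ y) = ((A t)ᵀ * A t) x y := by
  have : Nonempty (Fin 2 × Fin m) := ⟨x⟩
  have := (h.geodesic.signedPerm_equivariance σ hd (ε := 1) (t₀ := 0) (t₁ := 0) (one_mul 1) h₀
    (by simpa using h₁) t x y).1
  simpa using this

theorem gram_apply_of_block_ne (h : TwoClassData m₀ A lam mu z) (t : ℝ) {x y : Fin 2 × Fin m}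
    (hxy : x.2 ≠ y.2) : ((A t)ᵀ * A t) x y = 0 := by
  set d : Fin 2 × Fin m → ℝ := fun w => if w.2 = x.2 then -1 else 1 with hd
  have hdd : ∀ w, d w * d w = 1 := fun w => by simp only [hd]; split_ifs <;> norm_num
  have hinv : ∀ v w : Fin 2 × Fin m, v.2 = w.2 → d v * d w = 1 := fun v w hvw => by
    rw [show d v = d w by simp only [hd, hvw], hdd]
  have := h.gram_signedPerm (Equiv.refl _) hdd (fun v w => ?_) (fun v w => ?_) t x y
  · rw [show d x = -1 by simp [hd], show d y = 1 by simp [hd, hxy.symm]] at this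
    simp only [Equiv.refl_apply] at this
    linarith
  · rw [Equiv.refl_apply, Equiv.refl_apply, h.gram_zero]
    split_ifs with hvw
    · rw [hvw, hdd, one_mul]
    · rw [mul_zero]
  · rw [Equiv.refl_apply, Equiv.refl_apply, h.momentum_zero]
    split_ifs with hvw hvw'
    · rw [hvw, hdd, one_mul]
    · rw [hinv v w hvw', one_mul]
    · rw [mul_zero]

theorem gram_quarterTurn (h : TwoClassData m₀ A lam mu z) (t : ℝ) (a b : Fin 2) (i j : Fin m) :
    (if a = 0 then 1 else -1) * (if b = 0 then 1 else -1) *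
      ((A t)ᵀ * A t) (Equiv.swap 0 1 a, i) (Equiv.swap 0 1 b, j) =
      ((A t)ᵀ * A t) (a, i) (b, j) := by
  refine h.gram_signedPerm ((Equiv.swap 0 1).prodCongr (Equiv.refl _))
    (d := fun x => if x.1 = 0 then 1 else -1) (fun x => ?_) ?_ ?_ t (a, i) (b, j)
  · split_ifs <;> norm_num
  · rintro ⟨a, i⟩ ⟨b, j⟩
    rw [h.gram_zero, h.gram_zero]
    fin_cases a <;> fin_cases b <;> simp
  · rintro ⟨a, i⟩ ⟨b, j⟩
    rw [h.momentum_zero, h.momentum_zero]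
    fin_cases a <;> fin_cases b <;> simp [Z2, neg_div]

theorem gram_apply_of_ne (h : TwoClassData m₀ A lam mu z) (t : ℝ) {x y : Fin 2 × Fin m}
    (hxy : x ≠ y) : ((A t)ᵀ * A t) x y = 0 := by
  obtain ⟨a, i⟩ := x
  obtain ⟨b, j⟩ := y
  by_cases hij : i = j
  · subst hij
    have hsymm : ((A t)ᵀ * A t) (0, i) (1, i) = ((A t)ᵀ * A t) (1, i) (0, i) := by
      simp only [Matrix.mul_apply, Matrix.transpose_apply, mul_comm]
    have h1 := h.gram_quarterTurn t 0 1 i i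
    simp only [Equiv.swap_apply_left, Equiv.swap_apply_right, if_true, one_ne_zero, if_false] at h1
    fin_cases a <;> fin_cases b <;> simp at hxy ⊢ <;> linarith
  · exact h.gram_apply_of_block_ne t hij

theorem gram_one_one (h : TwoClassData m₀ A lam mu z) (t : ℝ) (i : Fin m) :
    ((A t)ᵀ * A t) (1, i) (1, i) = ((A t)ᵀ * A t) (0, i) (0, i) := by
  have h1 := h.gram_quarterTurn t 0 0 i i
  simpa using h1

theorem gram_apply_self (h : TwoClassData m₀ A lam mu z) (t : ℝ) (x : Fin 2 × Fin m) :
    ((A t)ᵀ * A t) x x = ((A t)ᵀ * A t) (0, x.2) (0, x.2) := by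
  obtain ⟨a, i⟩ := x
  fin_cases a
  · rfl
  · exact h.gram_one_one t i

theorem gram_eq_of_class_eq (h : TwoClassData m₀ A lam mu z) (t : ℝ) {i j : Fin m}
    (hij : (i : ℕ) < m₀ ↔ (j : ℕ) < m₀) :
    ((A t)ᵀ * A t) (0, i) (0, i) = ((A t)ᵀ * A t) (0, j) (0, j) := by
  have hswap : ∀ k : Fin m, ((Equiv.swap i j k : Fin m) : ℕ) < m₀ ↔ (k : ℕ) < m₀ := by
    intro k
    rcases eq_or_ne k i with rfl | hki
    · rw [Equiv.swap_apply_left, hij]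
    rcases eq_or_ne k j with rfl | hkj
    · rw [Equiv.swap_apply_right, hij]
    · rw [Equiv.swap_apply_of_ne_of_ne hki hkj]
  set d : Fin 2 × Fin m → ℝ := fun x => if x.1 = 0 then 1 else z x.2 / z (Equiv.swap i j x.2)
    with hd
  have hdd : ∀ x, d x * d x = 1 := by
    intro x
    simp only [hd]
    split_ifs
    · norm_num
    · rw [← sq, div_pow, h.sq_eq _ _ (hswap x.2), div_self (pow_ne_zero 2 (h.ne_zero _))]
  have := h.gram_signedPerm ((Equiv.refl _).prodCongr (Equiv.swap i j)) hdd
    (fun x y => ?_) (fun x y => ?_) t (0, i) (0, i)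
  · simpa [hd] using this.symm
  · rw [h.gram_zero, h.gram_zero]
    simp only [EmbeddingLike.apply_eq_iff_eq]
    split_ifs with hxy
    · rw [hxy, hdd, one_mul]
      exact h.lam_eq _ _ (hswap _)
    · rw [mul_zero]
  · rw [h.momentum_zero, h.momentum_zero]
    simp only [EmbeddingLike.apply_eq_iff_eq]
    split_ifs with hxy hxy1 hxy2 hxy3
    · rw [hxy, hdd, one_mul]
      exact congrArg (· / 2) (h.mu_eq _ _ (hswap _))
    · obtain ⟨a, k⟩ := x
      obtain ⟨b, l⟩ := y
      simp only at hxy2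
      subst hxy2
      have hz := h.ne_zero (Equiv.swap i j k)
      fin_cases a <;> fin_cases b <;> simp [hd, Z2] at hxy ⊢ <;> field_simp
    · exact absurd ((Equiv.swap i j).injective hxy1) hxy2
    · exact absurd (congrArg (Equiv.swap i j) hxy3) hxy1
    · rw [mul_zero]

theorem gram_eq_diagonal (h : TwoClassData m₀ A lam mu z) (t : ℝ) :
    (A t)ᵀ * A t = Matrix.diagonal fun x => ((A t)ᵀ * A t) (0, x.2) (0, x.2) := by
  ext x y
  by_cases hxy : x = y
  · rw [hxy, Matrix.diagonal_apply_eq, h.gram_apply_self]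
  · rw [Matrix.diagonal_apply_ne _ hxy, h.gram_apply_of_ne t hxy]

theorem gram_pos (h : TwoClassData m₀ A lam mu z) (t : ℝ) (i : Fin m) :
    0 < ((A t)ᵀ * A t) (0, i) (0, i) := by
  refine lt_of_le_of_ne ?_ fun h0 => ?_
  · rw [Matrix.mul_apply]
    exact Finset.sum_nonneg fun x _ => mul_self_nonneg _
  · have hdet : ((A t)ᵀ * A t).det = 1 := by
      rw [Matrix.det_mul, Matrix.det_transpose, h.geodesic.2.2.1, one_mul]
    rw [h.gram_eq_diagonal, Matrix.det_diagonal] at hdet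
    exact Finset.prod_ne_zero_iff.1 (hdet.trans_ne one_ne_zero) (0, i) (Finset.mem_univ _) h0.symm

theorem sum_log_gram (h : TwoClassData m₀ A lam mu z) (t : ℝ) :
    ∑ i, Real.log (((A t)ᵀ * A t) (0, i) (0, i)) = 0 := by
  have hdet : ((A t)ᵀ * A t).det = 1 := by
    rw [Matrix.det_mul, Matrix.det_transpose, h.geodesic.2.2.1, one_mul]
  rw [h.gram_eq_diagonal, Matrix.det_diagonal] at hdet
  have h1 := congrArg Real.log hdet
  rw [Real.log_prod (fun x _ => (h.gram_pos t x.2).ne'), Real.log_one,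
    Fintype.sum_prod_type, Fin.sum_univ_two] at h1
  linarith

theorem hasDerivAt_gram_apply (h : TwoClassData m₀ A lam mu z) (t : ℝ) (x y : Fin 2 × Fin m) :
    HasDerivAt (fun t => ((A t)ᵀ * A t) x y)
      (((A t)ᵀ * deriv A t) x y + ((A t)ᵀ * deriv A t) y x) t :=
  Matrix.hasDerivAt_iff.1 (h.geodesic.hasDerivAt_gram t) x y

theorem momentum_apply_of_ne (h : TwoClassData m₀ A lam mu z) (t : ℝ) {x y : Fin 2 × Fin m}
    (hxy : x ≠ y) :
    ((A t)ᵀ * deriv A t) x y = if x.2 = y.2 then z x.2 * Z2 x.1 y.1 / 2 else 0 := by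
  have h1 : ((A t)ᵀ * deriv A t) x y + ((A t)ᵀ * deriv A t) y x = 0 := by
    have h0 := h.hasDerivAt_gram_apply t x y
    simp only [h.gram_apply_of_ne _ hxy] at h0
    exact h0.unique (hasDerivAt_const t 0)
  have h2 := congrFun (congrFun (h.geodesic.angularMomentum_eq t) x) y
  simp only [Matrix.sub_apply, Matrix.transpose_apply, h.momentum_zero, hxy, hxy.symm,
    if_false, eq_comm (a := y.2)] at h2
  have h3 : Z2 y.1 x.1 = -Z2 x.1 y.1 := by
    generalize x.1 = a
    generalize y.1 = b
    fin_cases a <;> fin_cases b <;> simp [Z2]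
  split_ifs at h2 ⊢ with hb
  · rw [← hb, h3] at h2
    linarith
  · linarith

theorem momentum_apply_self (h : TwoClassData m₀ A lam mu z) (t : ℝ) (x : Fin 2 × Fin m) :
    ((A t)ᵀ * deriv A t) x x = ((A t)ᵀ * deriv A t) (0, x.2) (0, x.2) := by
  have h1 := h.hasDerivAt_gram_apply t x x
  simp only [h.gram_apply_self _ x] at h1
  have h2 := h1.unique (h.hasDerivAt_gram_apply t (0, x.2) (0, x.2))
  linarith

theorem momentum_eq_of_class_eq (h : TwoClassData m₀ A lam mu z) (t : ℝ) {i j : Fin m}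
    (hij : (i : ℕ) < m₀ ↔ (j : ℕ) < m₀) :
    ((A t)ᵀ * deriv A t) (0, i) (0, i) = ((A t)ᵀ * deriv A t) (0, j) (0, j) := by
  have h1 := h.hasDerivAt_gram_apply t (0, i) (0, i)
  simp only [h.gram_eq_of_class_eq _ hij] at h1
  have h2 := h1.unique (h.hasDerivAt_gram_apply t (0, j) (0, j))
  linarith

theorem hasDerivAt_momentum_apply (h : TwoClassData m₀ A lam mu z) (t : ℝ) (i : Fin m) :
    HasDerivAt (fun t => ((A t)ᵀ * deriv A t) (0, i) (0, i))
      ((((A t)ᵀ * deriv A t) (0, i) (0, i) ^ 2 + z i ^ 2 / 4) / ((A t)ᵀ * A t) (0, i) (0, i) +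
        geodesicForce (A t) (deriv A t)) t := by
  refine (Matrix.hasDerivAt_iff.1 (h.geodesic.hasDerivAt_momentum t) (0, i) (0, i)).congr_deriv ?_
  have hinv : ((A t)ᵀ * A t)⁻¹ =
      Matrix.diagonal fun x => (((A t)ᵀ * A t) (0, x.2) (0, x.2))⁻¹ := by
    refine Matrix.inv_eq_left_inv ?_
    conv_lhs => rw [h.gram_eq_diagonal t]
    rw [Matrix.diagonal_mul_diagonal, ← Matrix.diagonal_one]
    congr 1
    funext x
    simpa using inv_mul_cancel₀ (h.gram_pos t x.2).ne'
  rw [Matrix.add_apply, Matrix.smul_apply, Matrix.one_apply_eq, smul_eq_mul, mul_one,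
    h.geodesic.transpose_deriv_mul_deriv, hinv, Matrix.mul_apply, Fintype.sum_prod_type,
    Fin.sum_univ_two]
  simp only [Matrix.diagonal_mul, Matrix.transpose_apply]
  rw [Finset.sum_eq_single i, Finset.sum_eq_single i,
    h.momentum_apply_of_ne t (x := (1, i)) (y := (0, i)) (by simp)]
  · simp [Z2]
    ring
  · intro j _ hj
    rw [h.momentum_apply_of_ne t (by simp), if_neg hj, zero_mul]
  · simp
  · intro j _ hj
    rw [h.momentum_apply_of_ne t (by simpa using hj), if_neg hj, zero_mul]
  · simp

theorem pulsatingPair (h : TwoClassData m₀ A lam mu z) {i j : Fin m} (hi : (i : ℕ) < m₀)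
    (hj : m₀ ≤ (j : ℕ)) :
    PulsatingPair ((Finset.univ.filter fun k : Fin m => (k : ℕ) < m₀).card : ℝ)
      ((Finset.univ.filter fun k : Fin m => ¬ (k : ℕ) < m₀).card : ℝ) (z i ^ 2 / 4) (z j ^ 2 / 4)
      (fun t => geodesicForce (A t) (deriv A t))
      (fun t => ((A t)ᵀ * A t) (0, i) (0, i)) (fun t => ((A t)ᵀ * A t) (0, j) (0, j))
      (fun t => 2 * ((A t)ᵀ * deriv A t) (0, i) (0, i))
      (fun t => 2 * ((A t)ᵀ * deriv A t) (0, j) (0, j)) where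
  p_pos := Nat.cast_pos.2 (Finset.card_pos.2 ⟨i, by simpa using hi⟩)
  q_pos := Nat.cast_pos.2 (Finset.card_pos.2 ⟨j, by simpa using hj⟩)
  α_pos := by have := h.ne_zero i; positivity
  β_pos := by have := h.ne_zero j; positivity
  s_pos t := h.gram_pos t i
  r_pos t := h.gram_pos t j
  hasDerivAt_s t := (h.hasDerivAt_gram_apply t _ _).congr_deriv (two_mul _).symm
  hasDerivAt_r t := (h.hasDerivAt_gram_apply t _ _).congr_deriv (two_mul _).symm
  hasDerivAt_ds t := ((h.hasDerivAt_momentum_apply t i).const_mul 2).congr_deriv (by ring)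
  hasDerivAt_dr t := ((h.hasDerivAt_momentum_apply t j).const_mul 2).congr_deriv (by ring)
  log_eq t := by
    rw [← h.sum_log_gram t, ← Finset.sum_filter_add_sum_filter_not Finset.univ
      (fun k : Fin m => (k : ℕ) < m₀), ← nsmul_eq_mul, ← nsmul_eq_mul, ← Finset.sum_const,
      ← Finset.sum_const]
    congr 1
    · refine Finset.sum_congr rfl fun k hk => ?_
      rw [Finset.mem_filter] at hk
      rw [h.gram_eq_of_class_eq t (iff_of_true hi hk.2)]
    · refine Finset.sum_congr rfl fun k hk => ?_
      rw [Finset.mem_filter] at hk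
      rw [h.gram_eq_of_class_eq t (iff_of_false (not_lt.2 hj) hk.2)]

/-- At an instant where the radial velocities vanish, the motion is reversible. -/
theorem reflection (h : TwoClassData m₀ A lam mu z) {τ : ℝ}
    (hτ : ∀ i, ((A τ)ᵀ * deriv A τ) (0, i) (0, i) = 0) (t : ℝ) (x y : Fin 2 × Fin m) :
    (if x.1 = 0 then 1 else -1) * (if y.1 = 0 then 1 else -1) *
      ((A (τ - t))ᵀ * A (τ - t)) x y = ((A (τ + t))ᵀ * A (τ + t)) x y ∧
    -((if x.1 = 0 then 1 else -1) * (if y.1 = 0 then 1 else -1) *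
      ((A (τ - t))ᵀ * deriv A (τ - t)) x y) = ((A (τ + t))ᵀ * deriv A (τ + t)) x y := by
  have : Nonempty (Fin 2 × Fin m) := ⟨x⟩
  have key := h.geodesic.signedPerm_equivariance (Equiv.refl _)
    (d := fun x : Fin 2 × Fin m => if x.1 = 0 then 1 else -1)
    (fun x => by split_ifs <;> norm_num) (ε := -1) (t₀ := τ) (t₁ := τ) (by norm_num)
    (fun x y => ?_) (fun x y => ?_) t x y
  · rw [neg_one_mul, ← sub_eq_add_neg, neg_one_mul] at key
    exact key
  · rw [Equiv.refl_apply, Equiv.refl_apply]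
    by_cases hxy : x = y
    · subst hxy
      split_ifs <;> ring
    · rw [h.gram_apply_of_ne τ hxy, mul_zero]
  · rw [Equiv.refl_apply, Equiv.refl_apply]
    by_cases hxy : x = y
    · rw [hxy, h.momentum_apply_self, hτ, mul_zero, mul_zero]
    · rw [h.momentum_apply_of_ne τ hxy]
      obtain ⟨a, i⟩ := x
      obtain ⟨b, j⟩ := y
      by_cases hij : i = j
      · fin_cases a <;> fin_cases b <;> simp [hij, Z2]
      · simp [hij]

theorem periodic (h : TwoClassData m₀ A lam mu z) {τ₀ τ₁ : ℝ}
    (h₀ : ∀ i, ((A τ₀)ᵀ * deriv A τ₀) (0, i) (0, i) = 0)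
    (h₁ : ∀ i, ((A τ₁)ᵀ * deriv A τ₁) (0, i) (0, i) = 0) (t : ℝ) :
    (A (t + 2 * (τ₁ - τ₀)))ᵀ * A (t + 2 * (τ₁ - τ₀)) = (A t)ᵀ * A t ∧
    (A (t + 2 * (τ₁ - τ₀)))ᵀ * deriv A (t + 2 * (τ₁ - τ₀)) = (A t)ᵀ * deriv A t := by
  have key : ∀ x y : Fin 2 × Fin m, _ := fun x y =>
    And.intro (h.reflection h₀ (τ₀ - t) x y) (h.reflection h₁ (t + τ₁ - 2 * τ₀) x y)
  rw [show τ₀ - (τ₀ - t) = t by ring, show τ₀ + (τ₀ - t) = 2 * τ₀ - t by ring,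
    show τ₁ - (t + τ₁ - 2 * τ₀) = 2 * τ₀ - t by ring,
    show τ₁ + (t + τ₁ - 2 * τ₀) = t + 2 * (τ₁ - τ₀) by ring] at key
  constructor
  · ext x y
    obtain ⟨⟨h1, -⟩, h2, -⟩ := key x y
    rw [← h2, ← h1]
    split_ifs <;> ring
  · ext x y
    obtain ⟨⟨-, h1⟩, -, h2⟩ := key x y
    rw [← h2, ← h1]
    split_ifs <;> ring

end TwoClassData

/-- periodically pulsating block-diagonal solutions. If the
block-diagonal data takes only two values (split at index `m₀`) and all angular
momenta are nonzero, then `AᵀA` and `AᵀA'` are periodic in time. -/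
theorem statement_18 {m : ℕ} (hm : 2 ≤ m)
    (A : ℝ → Matrix (Fin 2 × Fin m) (Fin 2 × Fin m) ℝ) (hgeo : IsGeodesic A)
    (lam mu z : Fin m → ℝ)
    (h₁ : (A 0)ᵀ * A 0 =
      Matrix.blockDiagonal fun i => lam i • (1 : Matrix (Fin 2) (Fin 2) ℝ))
    (h₂ : (A 0)ᵀ * deriv A 0 + (deriv A 0)ᵀ * A 0 =
      Matrix.blockDiagonal fun i => mu i • (1 : Matrix (Fin 2) (Fin 2) ℝ))
    (h₃ : (A 0)ᵀ * deriv A 0 - (deriv A 0)ᵀ * A 0 =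
      Matrix.blockDiagonal fun i => z i • Z2)
    (m₀ : ℕ) (hm₀ : 1 ≤ m₀) (hm₀m : m₀ < m)
    (hzlo : ∀ i j : Fin m, (i : ℕ) < m₀ → (j : ℕ) < m₀ → |z i| = |z j|)
    (hzhi : ∀ i j : Fin m, m₀ ≤ (i : ℕ) → m₀ ≤ (j : ℕ) → |z i| = |z j|)
    (hzlo0 : ∀ i : Fin m, (i : ℕ) < m₀ → z i ≠ 0)
    (hzhi0 : ∀ i : Fin m, m₀ ≤ (i : ℕ) → z i ≠ 0)
    (hllo : ∀ i j : Fin m, (i : ℕ) < m₀ → (j : ℕ) < m₀ → lam i = lam j)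
    (hlhi : ∀ i j : Fin m, m₀ ≤ (i : ℕ) → m₀ ≤ (j : ℕ) → lam i = lam j)
    (hmlo : ∀ i j : Fin m, (i : ℕ) < m₀ → (j : ℕ) < m₀ → mu i = mu j)
    (hmhi : ∀ i j : Fin m, m₀ ≤ (i : ℕ) → m₀ ≤ (j : ℕ) → mu i = mu j) :
    ∃ T > (0 : ℝ), ∀ t : ℝ,
      (A (t + T))ᵀ * A (t + T) = (A t)ᵀ * A t ∧
      (A (t + T))ᵀ * deriv A (t + T) = (A t)ᵀ * deriv A t := by
  have hsplit : ∀ (f : Fin m → ℝ),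
      (∀ i j : Fin m, (i : ℕ) < m₀ → (j : ℕ) < m₀ → f i = f j) →
      (∀ i j : Fin m, m₀ ≤ (i : ℕ) → m₀ ≤ (j : ℕ) → f i = f j) →
      ∀ i j : Fin m, ((i : ℕ) < m₀ ↔ (j : ℕ) < m₀) → f i = f j := by
    intro f hlo hhi i j hij
    by_cases hi : (i : ℕ) < m₀
    · exact hlo i j hi (hij.1 hi)
    · exact hhi i j (not_lt.1 hi) (not_lt.1 fun hj => hi (hij.2 hj))
  have h : TwoClassData m₀ A lam mu z := by
    refine ⟨hgeo, ?_, ?_, ?_, ?_, hsplit lam hllo hlhi, hsplit mu hmlo hmhi⟩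
    · rintro ⟨a, i⟩ ⟨b, j⟩
      rw [h₁, Matrix.blockDiagonal_apply]
      by_cases hij : i = j <;> by_cases hab : a = b <;> simp [hij, hab]
    · rintro ⟨a, i⟩ ⟨b, j⟩
      have h4 := congrFun (congrFun h₂ (a, i)) (b, j)
      have h5 := congrFun (congrFun h₃ (a, i)) (b, j)
      rw [Matrix.blockDiagonal_apply, Matrix.add_apply] at h4
      rw [Matrix.blockDiagonal_apply, Matrix.sub_apply] at h5
      by_cases hij : i = j
      · by_cases hab : a = b
        · simp [hij, hab, Z2_apply_self] at h4 h5 ⊢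
          linarith
        · simp [hij, hab] at h4 h5 ⊢
          linarith
      · simp [hij] at h4 h5 ⊢
        linarith
    · intro i
      exact (lt_or_ge (i : ℕ) m₀).elim (hzlo0 i) (hzhi0 i)
    · intro i j hij
      rw [sq_eq_sq_iff_abs_eq_abs]
      exact hsplit (fun i => |z i|) hzlo hzhi i j hij
  let i : Fin m := ⟨0, by omega⟩
  let j : Fin m := ⟨m₀, hm₀m⟩
  have hi : (i : ℕ) < m₀ := hm₀
  have hj : m₀ ≤ (j : ℕ) := le_rfl
  have hpair := h.pulsatingPair hi hj
  have hrest : ∀ τ, 2 * ((A τ)ᵀ * deriv A τ) (0, i) (0, i) = 0 →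
      ∀ k, ((A τ)ᵀ * deriv A τ) (0, k) (0, k) = 0 := by
    intro τ hτ k
    have hτ' := (hpair.deriv_eq_zero_iff τ).1 hτ
    rcases lt_or_ge (k : ℕ) m₀ with hk | hk
    · rw [h.momentum_eq_of_class_eq τ (iff_of_true hk hi)]
      linarith
    · rw [h.momentum_eq_of_class_eq τ (iff_of_false (not_lt.2 hk) (not_lt.2 hj))]
      linarith
  obtain ⟨τ₀, -, h₀⟩ := hpair.exists_deriv_eq_zero 0
  obtain ⟨τ₁, hτ, h₁'⟩ := hpair.exists_deriv_eq_zero τ₀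
  exact ⟨2 * (τ₁ - τ₀), by linarith, h.periodic (hrest τ₀ h₀) (hrest τ₁ h₁')⟩
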